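/- Let G be a finite group with |CD(G)| = |L(G)| - 1. Then G is either a cyclic p-group for some prime p or a generalized quaternion 2-group of order 2^n for some n ≥ 3. -/

import Mathlib

/-- The Chermak-Delgado measure of a subgroup `H` of `G`: `m_G(H) = |H| * |C_G(H)|`. -/
noncomputable def cdMeasure (G : Type*) [Group G] (H : Subgroup G) : ℕ :=
  Nat.card H * Nat.card (Subgroup.centralizer (H : Set G))

/-- The Chermak-Delgado lattice of `G`: the set of subgroups whose Chermak-Delgado
measure is maximal among all subgroups of `G`. -/
def cdLattice (G : Type*) [Group G] : Set (Subgroup G) :=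
  {H | ∀ K : Subgroup G, cdMeasure G K ≤ cdMeasure G H}

section ChermakDelgado

variable {G : Type*} [Group G] [Finite G]

open Subgroup

theorem cdMeasure_bot : cdMeasure G ⊥ = Nat.card G := by
  simp [cdMeasure]

omit [Finite G] in
theorem cdMeasure_top : cdMeasure G ⊤ = Nat.card G * Nat.card (center G) := by
  simp [cdMeasure, centralizer_univ]

theorem center_le_of_mem_cdLattice {H : Subgroup G} (hH : H ∈ cdLattice G) : center G ≤ H := by
  have hC : centralizer (H : Set G) ≤ centralizer ((H ⊔ center G : Subgroup G) : Set G) := by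
    rw [le_centralizer_iff, sup_le_iff]
    exact ⟨le_centralizer_iff.mp le_rfl, center_le_centralizer _⟩
  have h1 := hH (H ⊔ center G)
  unfold cdMeasure at h1
  have h2 := Subgroup.card_le_of_le hC
  have h3 : Nat.card (H ⊔ center G : Subgroup G) ≤ Nat.card H :=
    Nat.le_of_mul_le_mul_right ((Nat.mul_le_mul_left _ h2).trans h1) Nat.card_pos
  exact le_sup_right.trans (Subgroup.eq_of_le_of_card_ge le_sup_left h3).ge

theorem exists_unique_notMem_cdLattice
    (h : Nat.card (cdLattice G) = Nat.card (Subgroup G) - 1) :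
    ∃! E : Subgroup G, E ∉ cdLattice G := by
  have h1 := Set.ncard_add_ncard_compl (cdLattice G)
  have h2 : 0 < Nat.card (Subgroup G) := Nat.card_pos
  have h3 : (cdLattice G).ncard = Nat.card (cdLattice G) := rfl
  have h4 : (cdLattice G)ᶜ.ncard = 1 := by omega
  obtain ⟨E, hE⟩ := Set.ncard_eq_one.mp h4
  refine ⟨E, ?_, fun F hF => ?_⟩
  · exact hE.ge rfl
  · exact hE.le hF

theorem sylow_notMem_cdLattice (hmax : (⊥ : Subgroup G) ∈ cdLattice G) {p : ℕ}
    [Fact p.Prime] (hp : p ∣ Nat.card G) (P : Sylow p G) : (P : Subgroup G) ∉ cdLattice G := by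
  intro hP
  have h1 : cdMeasure G P = Nat.card G := by
    rw [← cdMeasure_bot]
    exact le_antisymm (hmax _) (hP _)
  have hne : (P : Subgroup G) ≠ ⊥ := P.ne_bot_of_dvd_card hp
  have : Nontrivial (P : Subgroup G) := (Subgroup.nontrivial_iff_ne_bot _).mpr hne
  have hZ : Nontrivial (center (P : Subgroup G)) := P.isPGroup'.center_nontrivial
  have hpZ : p ∣ Nat.card (center (P : Subgroup G)) := by
    obtain ⟨n, hn0, hn⟩ :=
      (P.isPGroup'.to_subgroup (center (P : Subgroup G))).nontrivial_iff_card.mp hZ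
    rw [hn]
    exact dvd_pow_self p hn0.ne'
  have hle : (center (P : Subgroup G)).map (P : Subgroup G).subtype ≤
      centralizer ((P : Subgroup G) : Set G) := by
    rintro _ ⟨z, hz, rfl⟩
    rw [mem_centralizer_iff]
    intro g hg
    exact congrArg Subtype.val (mem_center_iff.mp hz ⟨g, hg⟩)
  have h2 := Subgroup.card_dvd_of_le hle
  rw [card_map_of_injective (Subgroup.subtype_injective _)] at h2
  have h3 : Nat.card (P : Subgroup G) * p ∣ Nat.card G := by
    rw [← h1]
    exact mul_dvd_mul_left _ (hpZ.trans h2)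
  rw [← (P : Subgroup G).card_mul_index] at h3
  exact P.not_dvd_index (Nat.dvd_of_mul_dvd_mul_left Nat.card_pos h3)

theorem center_ne_bot_of_exists_unique_notMem_cdLattice [Nontrivial G]
    (h : ∃! E : Subgroup G, E ∉ cdLattice G) : center G ≠ ⊥ := by
  intro hZ
  have h1 : cdMeasure G ⊤ = cdMeasure G ⊥ := by
    rw [cdMeasure_top, cdMeasure_bot, hZ]; simp
  have hbot : (⊥ : Subgroup G) ∈ cdLattice G := by
    by_contra hb
    have ht : (⊤ : Subgroup G) ∉ cdLattice G := by
      intro ht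
      exact hb fun K => (ht K).trans h1.le
    exact bot_ne_top (h.unique hb ht)
  have key : ∀ {q : ℕ}, q.Prime → q ∣ Nat.card G →
      Nat.card h.choose = q ^ (Nat.card G).factorization q := by
    intro q hq hd
    have : Fact q.Prime := ⟨hq⟩
    let P : Sylow q G := default
    rw [← h.unique (sylow_notMem_cdLattice hbot hd P) h.choose_spec.1]
    exact P.card_eq_multiplicity
  have hc1 : Nat.card G ≠ 1 := Finite.one_lt_card.ne'
  obtain ⟨p, hp, hpd⟩ := Nat.exists_prime_and_dvd hc1
  have : Fact p.Prime := ⟨hp⟩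
  have hG : IsPGroup p G := by
    rw [IsPGroup.iff_card]
    refine ⟨_, Nat.eq_prime_pow_of_unique_prime_dvd Nat.card_pos.ne' fun {q} hq hd => ?_⟩
    have h2 := (key hq hd).symm.trans (key hp hpd)
    have h3 : q ∣ p ^ (Nat.card G).factorization p := by
      rw [← h2]
      exact dvd_pow_self q (hq.factorization_pos_of_dvd Nat.card_pos.ne' hd).ne'
    exact (Nat.prime_dvd_prime_iff_eq hq hp).mp (hq.dvd_of_dvd_pow h3)
  exact (Subgroup.nontrivial_iff_ne_bot _).mp hG.center_nontrivial hZ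

end ChermakDelgado

section CentralExtension

variable {G : Type*} [Group G]

theorem pow_mul_eq_of_mul_eq {u y c : G} (hc : c ∈ Subgroup.center G) (h : y * u = u * y * c)
    (n : ℕ) : y ^ n * u = u * y ^ n * c ^ n := by
  induction n with
  | zero => simp
  | succ n ih =>
    have hcy : c ^ n * y = y * c ^ n :=
      (Subgroup.mem_center_iff.mp (pow_mem hc n) y).symm
    calc y ^ (n + 1) * u = y ^ n * (y * u) := by rw [pow_succ, mul_assoc]
      _ = (y ^ n * u) * y * c := by rw [h]; group
      _ = u * y ^ n * (c ^ n * y) * c := by rw [ih]; group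
      _ = u * y ^ (n + 1) * c ^ (n + 1) := by rw [hcy]; group

theorem mul_pow_of_mul_eq {u y c : G} (hc : c ∈ Subgroup.center G) (h : y * u = u * y * c)
    (n : ℕ) : (u * y) ^ n = u ^ n * y ^ n * c ^ n.choose 2 := by
  induction n with
  | zero => simp
  | succ n ih =>
    have h1 : c ^ n.choose 2 * (u * y) = u * y * c ^ n.choose 2 :=
      (Subgroup.mem_center_iff.mp (pow_mem hc _) _).symm
    have h2 : c ^ n * y = y * c ^ n :=
      (Subgroup.mem_center_iff.mp (pow_mem hc n) y).symm
    calc (u * y) ^ (n + 1) = u ^ n * y ^ n * (c ^ n.choose 2 * (u * y)) := by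
          rw [pow_succ, ih, mul_assoc]
      _ = u ^ n * (y ^ n * u) * y * c ^ n.choose 2 := by rw [h1]; group
      _ = u ^ n * u * y ^ n * (c ^ n * y) * c ^ n.choose 2 := by
          rw [pow_mul_eq_of_mul_eq hc h]; group
      _ = u ^ (n + 1) * y ^ (n + 1) * (c ^ n * c ^ n.choose 2) := by
          rw [h2]; simp only [pow_succ, mul_assoc]
      _ = _ := by rw [← pow_add, Nat.choose_succ_succ' n 1, Nat.choose_one_right]

/-- Generators `x`, `y` of a quaternion group of order eight. -/
theorem nonempty_mulEquiv_quaternionGroup_two [Finite G] (hcard : Nat.card G = 8) {x y : G}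
    (hx : orderOf x = 4) (hy : y ∉ Subgroup.zpowers x) (hy2 : y ^ 2 = x ^ 2)
    (hxy : x * y = y * x⁻¹) : Nonempty (G ≃* QuaternionGroup 2) := by
  let X : ZMod (2 * 2) → G := fun i => x ^ i.val
  have X_add : ∀ i j, X (i + j) = X i * X j := by
    intro i j
    simp only [X]
    rw [ZMod.val_add, ← pow_add, ← pow_mod_orderOf x (i.val + j.val), hx]
  have X_zero : X 0 = 1 := by simp [X]
  have X_two : X 2 = x ^ 2 := rfl
  have X_neg : ∀ i, X (-i) = (X i)⁻¹ := by
    intro i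
    rw [eq_inv_iff_mul_eq_one, ← X_add, neg_add_cancel, X_zero]
  have X_sub : ∀ i j, X (i - j) = (X j)⁻¹ * X i := by
    intro i j
    rw [sub_eq_neg_add, X_add, X_neg]
  have X_y : ∀ i, X i * y = y * (X i)⁻¹ := by
    intro i
    have : SemiconjBy y x⁻¹ x := hxy.symm
    have := this.pow_right i.val
    rw [inv_pow] at this
    exact this.eq.symm
  let f : QuaternionGroup 2 →* G := MonoidHom.mk'
    (fun q => match q with
      | .a i => X i
      | .xa i => y * X i) (by
      rintro (i | i) (j | j)
      · exact X_add i j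
      · change y * X (j - i) = X i * (y * X j)
        rw [X_sub, ← mul_assoc, ← mul_assoc, X_y]
      · change y * X (i + j) = y * X i * X j
        rw [X_add, mul_assoc]
      · change X (((2 : ℕ) : ZMod (2 * 2)) + j - i) = y * X i * (y * X j)
        rw [show y * X i * (y * X j) = y * (X i * y) * X j by group, X_y, add_sub_assoc, X_add,
          X_sub, Nat.cast_ofNat, X_two, ← hy2, pow_two]
        group)
  have hf : Function.Injective f := by
    rw [injective_iff_map_eq_one]
    rintro (i | i) hi
    · change x ^ i.val = 1 at hi
      have h4 := orderOf_dvd_of_pow_eq_one hi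
      rw [hx] at h4
      have : i.val = 0 := Nat.eq_zero_of_dvd_of_lt h4 (ZMod.val_lt i)
      rw [(ZMod.val_eq_zero i).mp this]
      rfl
    · change y * x ^ i.val = 1 at hi
      refine absurd ?_ hy
      rw [eq_inv_of_mul_eq_one_left hi]
      exact inv_mem (Subgroup.npow_mem_zpowers x _)
  have hb : Function.Bijective f := by
    rw [Nat.bijective_iff_injective_and_card]
    refine ⟨hf, ?_⟩
    rw [hcard, Nat.card_eq_fintype_card, QuaternionGroup.card]
  exact ⟨(MulEquiv.ofBijective f hb).symm⟩

end CentralExtension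

section PrimeCenter

variable {G : Type*} [Group G] [Finite G]

open Subgroup

/-- Every nontrivial subgroup of `G` attains the Chermak-Delgado measure of `G`, and `G` is a
`p`-group whose centre has order `p` and lies in every nontrivial subgroup. -/
structure IsCDSaturated (p : ℕ) (G : Type*) [Group G] : Prop where
  card_mul_card_centralizer : ∀ H : Subgroup G, H ≠ ⊥ →
    Nat.card H * Nat.card (centralizer (H : Set G)) = Nat.card G * p
  center_le : ∀ H : Subgroup G, H ≠ ⊥ → center G ≤ H
  card_center : Nat.card (center G) = p
  isPGroup : IsPGroup p G

theorem exists_isCDSaturated [Nontrivial G] (h : ∃! E : Subgroup G, E ∉ cdLattice G) :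
    ∃ p : ℕ, p.Prime ∧ IsCDSaturated p G := by
  have hZ := center_ne_bot_of_exists_unique_notMem_cdLattice h
  have hZc : 1 < Nat.card (center G) := (Subgroup.one_lt_card_iff_ne_bot _).mpr hZ
  have hbot : (⊥ : Subgroup G) ∉ cdLattice G := by
    intro hb
    have := hb ⊤
    rw [cdMeasure_top, cdMeasure_bot] at this
    nlinarith [Nat.card_pos (α := G)]
  have hmem : ∀ H : Subgroup G, H ≠ ⊥ → H ∈ cdLattice G := by
    intro H hH
    by_contra hn
    exact hH (h.unique hn hbot)
  have hle : ∀ H : Subgroup G, H ≠ ⊥ → center G ≤ H :=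
    fun H hH => center_le_of_mem_cdLattice (hmem H hH)
  have hdvd : ∀ q : ℕ, q.Prime → q ∣ Nat.card G → Nat.card (center G) = q := by
    intro q hq hd
    have : Fact q.Prime := ⟨hq⟩
    obtain ⟨g, hg⟩ := exists_prime_orderOf_dvd_card' q hd
    have hg1 : zpowers g ≠ ⊥ := by
      rw [Ne, zpowers_eq_bot]
      rintro rfl
      exact hq.one_lt.ne (orderOf_one.symm.trans hg)
    have h1 := Subgroup.card_dvd_of_le (hle _ hg1)
    rw [Nat.card_zpowers, hg] at h1
    exact ((Nat.dvd_prime hq).mp h1).resolve_left hZc.ne'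
  obtain ⟨p, hp, hpd⟩ := Nat.exists_prime_and_dvd hZc.ne'
  have hpG := hpd.trans (Subgroup.card_subgroup_dvd_card _)
  have hcZ := hdvd p hp hpG
  refine ⟨p, hp, fun H hH => ?_, hle, hcZ, ?_⟩
  · have := le_antisymm (hmem ⊤ top_ne_bot H) (hmem H hH ⊤)
    rwa [cdMeasure_top, hcZ] at this
  · have : Fact p.Prime := ⟨hp⟩
    rw [IsPGroup.iff_card]
    exact ⟨_, Nat.eq_prime_pow_of_unique_prime_dvd Nat.card_pos.ne'
      fun {q} hq hd => (hdvd q hq hd).symm.trans hcZ⟩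

namespace IsCDSaturated

section

variable {p : ℕ} [hp : Fact p.Prime] (hG : IsCDSaturated p G)

include hG

theorem mem_center_of_pow_eq_one {x : G} (hx : x ^ p = 1) : x ∈ center G := by
  by_cases h1 : x = 1
  · rw [h1]; exact one_mem _
  have hz : zpowers x ≠ ⊥ := fun h => h1 (zpowers_eq_bot.mp h)
  have hc : Nat.card (zpowers x) = p := by
    rw [Nat.card_zpowers]; exact orderOf_eq_prime hx h1
  rw [Subgroup.eq_of_le_of_card_ge (hG.center_le _ hz) (hc.trans hG.card_center.symm).le]
  exact mem_zpowers x

omit [Finite G] hp in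
theorem pow_eq_one_of_mem_center {x : G} (hx : x ∈ center G) : x ^ p = 1 := by
  rw [← hG.card_center]
  exact congrArg Subtype.val (pow_card_eq_one' (x := (⟨x, hx⟩ : center G)))

omit [Finite G] in
theorem notMem_center {x : G} (hx : orderOf x = p ^ 2) : x ∉ center G := by
  intro h
  have h1 := orderOf_dvd_of_pow_eq_one (hG.pow_eq_one_of_mem_center h)
  rw [hx] at h1
  have h2 := Nat.le_of_dvd hp.out.pos h1
  nlinarith [hp.out.one_lt]

omit [Finite G] in
theorem zpowers_ne_bot {x : G} (hx : orderOf x = p ^ 2) : zpowers x ≠ ⊥ := by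
  rw [Ne, zpowers_eq_bot]
  rintro rfl
  exact hG.notMem_center hx (one_mem _)

theorem mem_center_pow {x : G} (hx : orderOf x = p ^ 2) : x ^ p ∈ center G := by
  apply hG.mem_center_of_pow_eq_one
  rw [← pow_mul, ← pow_two, ← hx, pow_orderOf_eq_one]

omit [Finite G] in
theorem exists_orderOf_pow_eq {g : G} {k : ℕ} (hg : ¬ g ^ p ^ k = 1) :
    ∃ m : ℕ, orderOf (g ^ m) = p ^ (k + 1) := by
  obtain ⟨n, hn⟩ := IsPGroup.iff_orderOf.mp hG.isPGroup g
  have hk : k < n := by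
    by_contra! hle
    exact hg (orderOf_dvd_iff_pow_eq_one.mp (hn ▸ pow_dvd_pow p hle))
  refine ⟨p ^ (n - (k + 1)), ?_⟩
  have hpp : 0 < p := hp.out.pos
  rw [orderOf_pow_of_dvd (pow_pos hpp _).ne' (hn ▸ pow_dvd_pow p (Nat.sub_le _ _)), hn,
    Nat.pow_div (Nat.sub_le _ _) hpp]
  congr 1
  omega

theorem exists_orderOf_pow_eq_sq {g : G} (hg : g ∉ center G) :
    ∃ m : ℕ, orderOf (g ^ m) = p ^ 2 :=
  hG.exists_orderOf_pow_eq (k := 1) fun h => hg (hG.mem_center_of_pow_eq_one (pow_one p ▸ h))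

omit [Finite G] in
theorem card_centralizer {x : G} (hx : orderOf x = p ^ 2) :
    p * Nat.card (centralizer (zpowers x : Set G)) = Nat.card G := by
  have h1 := hG.card_mul_card_centralizer _ (hG.zpowers_ne_bot hx)
  rw [Nat.card_zpowers, hx] at h1
  apply Nat.eq_of_mul_eq_mul_right hp.out.pos
  rw [← h1]; ring

theorem centralizer_centralizer {H : Subgroup G} (hH : H ≠ ⊥) :
    centralizer (centralizer (H : Set G) : Set G) = H := by
  have hle : H ≤ centralizer (centralizer (H : Set G) : Set G) :=
    le_centralizer_iff.mp le_rfl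
  have hC : centralizer (H : Set G) ≠ ⊥ := by
    intro h
    have := (center_le_centralizer (H : Set G)).trans h.le
    have h2 := hG.card_center
    rw [le_bot_iff.mp this, card_bot] at h2
    exact hp.out.one_lt.ne h2
  have h1 := hG.card_mul_card_centralizer H hH
  have h2 := hG.card_mul_card_centralizer _ hC
  refine (Subgroup.eq_of_le_of_card_ge hle ?_).symm
  rw [← h1, mul_comm (Nat.card H)] at h2
  exact (Nat.eq_of_mul_eq_mul_left Nat.card_pos h2).le

theorem normal_zpowers {x : G} (hx : orderOf x = p ^ 2) : (zpowers x).Normal := by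
  have hc := hG.card_centralizer hx
  have hi : (centralizer (zpowers x : Set G)).index = p := by
    have := (centralizer (zpowers x : Set G)).card_mul_index
    rw [← hc, mul_comm p] at this
    exact Nat.eq_of_mul_eq_mul_left Nat.card_pos this
  have hmin : (Nat.card G).minFac = p := by
    obtain ⟨n, hn⟩ := IsPGroup.iff_card.mp hG.isPGroup
    have hn0 : n ≠ 0 := by
      rintro rfl
      rw [pow_zero] at hn
      exact hp.out.one_lt.ne' (Nat.dvd_one.mp (hn ▸ Dvd.intro _ hc))
    rw [hn, hp.out.pow_minFac hn0]
  have : (centralizer (zpowers x : Set G)).Normal :=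
    normal_of_index_eq_minFac_card (hi.trans hmin.symm)
  rw [← hG.centralizer_centralizer (hG.zpowers_ne_bot hx)]
  infer_instance

theorem commutator_mem_center {x : G} (hx : orderOf x = p ^ 2) (g : G) :
    g * x * g⁻¹ * x⁻¹ ∈ center G := by
  apply hG.mem_center_of_pow_eq_one
  obtain ⟨k, hk⟩ := mem_zpowers_iff.mp ((hG.normal_zpowers hx).conj_mem x (mem_zpowers x) g)
  have hcomm : Commute (g * x * g⁻¹) x⁻¹ := by
    rw [← hk]
    exact ((Commute.refl x).zpow_left k).inv_right
  rw [hcomm.mul_pow, conj_pow, mem_center_iff.mp (hG.mem_center_pow hx) g, inv_pow]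
  group

theorem exists_zpow_eq {x y : G} (hx : orderOf x = p ^ 2) (hy : orderOf y = p ^ 2) :
    ∃ k : ℤ, (x ^ k) ^ p * y ^ p = 1 := by
  have h1 : zpowers (x ^ p) ≠ ⊥ := by
    rw [Ne, zpowers_eq_bot]
    intro h
    exact hG.notMem_center hx (hG.mem_center_of_pow_eq_one h)
  obtain ⟨k, hk⟩ := mem_zpowers_iff.mp (hG.center_le _ h1 (hG.mem_center_pow hy))
  refine ⟨-k, ?_⟩
  rw [← hk, ← zpow_natCast, ← zpow_natCast, ← zpow_mul, ← zpow_mul, ← zpow_add]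
  have : -k * (p : ℤ) + p * k = 0 := by ring
  rw [this, zpow_zero]

omit [Finite G] in
theorem mem_zpowers_of_mul_mem_center {x y : G} (hx : orderOf x = p ^ 2) {k : ℤ}
    (h : x ^ k * y ∈ center G) : y ∈ zpowers x := by
  have h1 := hG.center_le _ (hG.zpowers_ne_bot hx) h
  exact (Subgroup.mul_mem_cancel_left _ (zpow_mem (mem_zpowers x) k)).mp h1

theorem mem_zpowers_of_commute {x y : G} (hx : orderOf x = p ^ 2) (hy : orderOf y = p ^ 2)
    (hxy : Commute x y) : y ∈ zpowers x := by
  obtain ⟨k, hk⟩ := hG.exists_zpow_eq hx hy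
  apply hG.mem_zpowers_of_mul_mem_center hx (k := k)
  apply hG.mem_center_of_pow_eq_one
  rw [(hxy.zpow_left k).mul_pow, hk]

theorem mem_zpowers_of_ne_two (hp2 : p ≠ 2) {x y : G} (hx : orderOf x = p ^ 2)
    (hy : orderOf y = p ^ 2) : y ∈ zpowers x := by
  obtain ⟨k, hk⟩ := hG.exists_zpow_eq hx hy
  apply hG.mem_zpowers_of_mul_mem_center hx (k := k)
  apply hG.mem_center_of_pow_eq_one
  have hc := hG.commutator_mem_center hy (x ^ k)⁻¹
  have hc' : y⁻¹ * ((x ^ k)⁻¹ * y * x ^ k) ∈ center G := by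
    have := (Subgroup.instNormalCenter).conj_mem _ hc y⁻¹
    convert this using 1
    group
  have h : y * x ^ k = x ^ k * y * (y⁻¹ * (x ^ k)⁻¹ * y * x ^ k) := by group
  rw [mul_pow_of_mul_eq (by convert hc' using 1; group) h, hk, one_mul]
  obtain ⟨m, hm⟩ := hp.out.dvd_choose_self (k := 2) two_ne_zero
    (lt_of_le_of_ne hp.out.two_le hp2.symm)
  rw [hm, pow_mul, show y⁻¹ * (x ^ k)⁻¹ * y * x ^ k = y⁻¹ * ((x ^ k)⁻¹ * y * x ^ k) by group,
    hG.pow_eq_one_of_mem_center hc', one_pow]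

theorem exists_notMem_zpowers {x : G} (hx : orderOf x = p ^ 2) :
    ∃ y : G, orderOf y = p ^ 2 ∧ y ∉ zpowers x := by
  by_contra! hall
  apply hG.notMem_center hx
  rw [mem_center_iff]
  intro g
  by_cases hg : g ∈ center G
  · exact (mem_center_iff.mp hg x).symm
  obtain ⟨m, hm⟩ := hG.exists_orderOf_pow_eq_sq hg
  have hle : zpowers (g ^ m) ≤ zpowers x := by
    rw [zpowers_le]; exact hall _ hm
  have heq := Subgroup.eq_of_le_of_card_ge hle (by rw [Nat.card_zpowers, Nat.card_zpowers, hm, hx])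
  have hxm : x ∈ zpowers (g ^ m) := heq ▸ mem_zpowers x
  obtain ⟨k, hk⟩ := mem_zpowers_iff.mp hxm
  rw [← hk]
  exact (((Commute.refl g).pow_right m).zpow_right k).eq

end

theorem nonempty_mulEquiv_quaternionGroup (hG : IsCDSaturated 2 G) (hZ : center G ≠ ⊤) :
    Nonempty (G ≃* QuaternionGroup 2) := by
  have : Fact (Nat.Prime 2) := ⟨Nat.prime_two⟩
  have exp4 : ∀ g : G, g ^ 2 ^ 2 = 1 := by
    intro g
    by_contra hg
    obtain ⟨m, hm⟩ := hG.exists_orderOf_pow_eq hg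
    set w := g ^ m
    have hw : orderOf (w ^ 2) = 2 ^ 2 := by
      rw [orderOf_pow_of_dvd two_ne_zero (by rw [hm]; norm_num), hm]; norm_num
    obtain ⟨u, hu, hun⟩ := hG.exists_notMem_zpowers hw
    refine hun (hG.mem_zpowers_of_commute hw hu ?_)
    have hc := hG.commutator_mem_center hu w
    have hc2 := hG.pow_eq_one_of_mem_center hc
    obtain ⟨c, hcdef⟩ : ∃ c, w * u * w⁻¹ * u⁻¹ = c := ⟨_, rfl⟩
    rw [hcdef] at hc hc2
    have hwu : w * u = c * (u * w) := by rw [← hcdef]; group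
    have hcw : w * c = c * w := mem_center_iff.mp hc w
    change w ^ 2 * u = u * w ^ 2
    calc w ^ 2 * u = w * (w * u) := by rw [pow_two, mul_assoc]
      _ = w * c * (u * w) := by rw [hwu, ← mul_assoc w c]
      _ = c * (w * u) * w := by rw [hcw]; simp only [mul_assoc]
      _ = c ^ 2 * (u * w ^ 2) := by rw [hwu]; simp only [pow_two, mul_assoc]
      _ = u * w ^ 2 := by rw [hc2, one_mul]
  have ord4 : ∀ g : G, g ∉ center G → orderOf g = 2 ^ 2 := fun g hg =>
    orderOf_eq_prime_pow (fun h => hg (hG.mem_center_of_pow_eq_one (pow_one 2 ▸ h))) (exp4 g)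
  obtain ⟨x, -, hxZ⟩ := SetLike.exists_of_lt (lt_top_iff_ne_top.mpr hZ)
  have hx := ord4 x hxZ
  have hC : centralizer (zpowers x : Set G) = zpowers x := by
    apply le_antisymm
    · intro y hy
      by_cases hyZ : y ∈ center G
      · exact hG.center_le _ (hG.zpowers_ne_bot hx) hyZ
      · exact hG.mem_zpowers_of_commute hx (ord4 y hyZ)
          (mem_centralizer_iff.mp hy x (mem_zpowers x))
    · exact le_centralizer (zpowers x)
  have hcard : Nat.card G = 8 := by
    rw [← hG.card_centralizer hx, hC, Nat.card_zpowers, hx]; norm_num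
  obtain ⟨y, hy, hyx⟩ := hG.exists_notMem_zpowers hx
  have eq_of_mem : ∀ {a b : G}, a ∈ center G → b ∈ center G → a ≠ 1 → b ≠ 1 → a = b := by
    intro a b ha hb ha1 hb1
    have h2 : zpowers a ≠ ⊥ := fun h => ha1 (zpowers_eq_bot.mp h)
    obtain ⟨k, hk⟩ := mem_zpowers_iff.mp (hG.center_le _ h2 hb)
    have ha2 : a ^ (2 : ℤ) = 1 := by exact_mod_cast hG.pow_eq_one_of_mem_center ha
    rcases Int.even_or_odd' k with ⟨j, rfl | rfl⟩
    · rw [zpow_mul, ha2, one_zpow] at hk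
      exact absurd hk.symm hb1
    · rw [zpow_add, zpow_mul, ha2, one_zpow, one_mul, zpow_one] at hk
      exact hk
  have sq_ne : ∀ {a : G}, orderOf a = 2 ^ 2 → a ^ 2 ≠ 1 := fun ha h =>
    hG.notMem_center ha (hG.mem_center_of_pow_eq_one h)
  have hy2 : y ^ 2 = x ^ 2 :=
    eq_of_mem (hG.mem_center_pow hy) (hG.mem_center_pow hx) (sq_ne hy) (sq_ne hx)
  have hcomm : x * y * x⁻¹ * y⁻¹ = x ^ 2 := by
    refine eq_of_mem (hG.commutator_mem_center hy x) (hG.mem_center_pow hx) (fun h => ?_) (sq_ne hx)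
    refine hyx (hG.mem_zpowers_of_commute hx hy ?_)
    rw [mul_inv_eq_one, mul_inv_eq_iff_eq_mul] at h
    exact h
  refine nonempty_mulEquiv_quaternionGroup_two hcard hx hyx hy2 ?_
  have h4 : x ^ 2 * x ^ 2 = 1 := by rw [← pow_add]; exact exp4 x
  have h5 := mem_center_iff.mp (hG.mem_center_pow hx) y
  calc x * y = x ^ 2 * (y * x) := by rw [← hcomm]; group
    _ = y * x ^ 2 * x := by rw [h5, mul_assoc]
    _ = y * (x ^ 2 * x ^ 2) * x⁻¹ := by simp only [pow_two, mul_assoc, mul_inv_cancel, mul_one]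
    _ = y * x⁻¹ := by rw [h4, mul_one]

end IsCDSaturated

end PrimeCenter

/-- If a finite group `G` satisfies `|CD(G)| = |L(G)| - 1`, then `G` is either a
cyclic `p`-group for some prime `p`, or a generalized quaternion `2`-group of order
`2^n` for some `n ≥ 3` (realized as `QuaternionGroup (2^(n-2))`). -/
theorem cd_eq_sub_one_cyclic_or_quaternion (G : Type*) [Group G] [Finite G]
    (h : Nat.card (cdLattice G) = Nat.card (Subgroup G) - 1) :
    (∃ p : ℕ, p.Prime ∧ IsPGroup p G ∧ IsCyclic G) ∨
      ∃ n : ℕ, 3 ≤ n ∧ Nonempty (G ≃* QuaternionGroup (2 ^ (n - 2))) := by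
  rcases subsingleton_or_nontrivial G with hs | hn
  · exact Or.inl ⟨2, Nat.prime_two, IsPGroup.of_card (n := 0) (by simp), inferInstance⟩
  obtain ⟨p, hp, hG⟩ := exists_isCDSaturated (exists_unique_notMem_cdLattice h)
  have : Fact p.Prime := ⟨hp⟩
  by_cases hZ : Subgroup.center G = ⊤
  · have hc := hG.card_center
    rw [hZ, Subgroup.card_top] at hc
    exact Or.inl ⟨p, hp, hG.isPGroup, isCyclic_of_prime_card hc⟩
  · right
    obtain rfl : p = 2 := by
      by_contra hp2
      obtain ⟨g, -, hg⟩ := SetLike.exists_of_lt (lt_top_iff_ne_top.mpr hZ)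
      obtain ⟨m, hm⟩ := hG.exists_orderOf_pow_eq_sq hg
      obtain ⟨y, hy, hyx⟩ := hG.exists_notMem_zpowers hm
      exact hyx (hG.mem_zpowers_of_ne_two hp2 hm hy)
    exact ⟨3, le_rfl, hG.nonempty_mulEquiv_quaternionGroup hZ⟩
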